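/- Let $c \ge 0$ and $n > c$ be real numbers. Then the Rényi entropy of order 2, $R_{n,c}(x) := -\log S_{n,c}(x)$, is concave and increasing on $[0,+\infty)$. -/

import Mathlib

/-- Generalized binomial coefficient `α(α-1)⋯(α-k+1)/k!`. -/
noncomputable def genBinom (α : ℝ) (k : ℕ) : ℝ :=
  (∏ i ∈ Finset.range k, (α - i)) / (Nat.factorial k)

/-- The basic probabilities `p_{n,k}^{[c]}(x)` for `c ≥ 0`. -/
noncomputable def pc (c n : ℝ) (k : ℕ) (x : ℝ) : ℝ :=
  if c = 0 then (n * x) ^ k / (Nat.factorial k) * Real.exp (-(n * x))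
  else (-1 : ℝ) ^ k * genBinom (-n / c) k * (c * x) ^ k
    * (1 + c * x) ^ (-n / c - (k : ℝ))

/-- `S_{n,c}(x) = ∑_{k=0}^∞ (p_{n,k}^{[c]}(x))²`. -/
noncomputable def Sc (c n : ℝ) (x : ℝ) : ℝ :=
  ∑' k : ℕ, (pc c n k x) ^ 2

/-- The Rényi entropy of order 2: `R_{n,c}(x) = -log S_{n,c}(x)`. -/
noncomputable def Rc (c n : ℝ) (x : ℝ) : ℝ := -Real.log (Sc c n x)

/-- A positive function `f` whose logarithm is convex on `s`, in multiplicative form. -/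
def IsLogConvexOn (s : Set ℝ) (f : ℝ → ℝ) : Prop :=
  (∀ x ∈ s, 0 < f x) ∧ ∀ x ∈ s, ∀ y ∈ s, ∀ a b : ℝ, 0 ≤ a → 0 ≤ b → a + b = 1 →
    f (a * x + b * y) ≤ f x ^ a * f y ^ b

namespace IsLogConvexOn

variable {s : Set ℝ} {f g : ℝ → ℝ}

theorem const {C : ℝ} (hC : 0 < C) : IsLogConvexOn s (fun _ => C) := by
  refine ⟨fun _ _ => hC, fun x _ y _ a b _ _ hab => ?_⟩
  rw [← Real.rpow_add hC, hab, Real.rpow_one]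

theorem mul (hf : IsLogConvexOn s f) (hg : IsLogConvexOn s g) (hs : Convex ℝ s) :
    IsLogConvexOn s (fun x => f x * g x) := by
  refine ⟨fun x hx => mul_pos (hf.1 x hx) (hg.1 x hx), fun x hx y hy a b ha hb hab => ?_⟩
  have hz : a * x + b * y ∈ s := hs hx hy ha hb hab
  have := hf.1 x hx
  have := hf.1 y hy
  have := hg.1 x hx
  have := hg.1 y hy
  rw [Real.mul_rpow (by positivity) (by positivity), Real.mul_rpow (by positivity) (by positivity)]
  calc f (a * x + b * y) * g (a * x + b * y)
      ≤ (f x ^ a * f y ^ b) * (g x ^ a * g y ^ b) :=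
        mul_le_mul (hf.2 x hx y hy a b ha hb hab) (hg.2 x hx y hy a b ha hb hab)
          (hg.1 _ hz).le (by positivity)
    _ = _ := by ring

theorem rpow_const (hf : IsLogConvexOn s f) (hs : Convex ℝ s) {p : ℝ} (hp : 0 ≤ p) :
    IsLogConvexOn s (fun x => f x ^ p) := by
  refine ⟨fun x hx => Real.rpow_pos_of_pos (hf.1 x hx) p, fun x hx y hy a b ha hb hab => ?_⟩
  have hz : a * x + b * y ∈ s := hs hx hy ha hb hab
  have h1 := hf.1 x hx
  have h2 := hf.1 y hy
  calc f (a * x + b * y) ^ p ≤ (f x ^ a * f y ^ b) ^ p :=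
        Real.rpow_le_rpow (hf.1 _ hz).le (hf.2 x hx y hy a b ha hb hab) hp
    _ = (f x ^ p) ^ a * (f y ^ p) ^ b := by
        rw [Real.mul_rpow (by positivity) (by positivity), ← Real.rpow_mul h1.le,
          ← Real.rpow_mul h2.le, ← Real.rpow_mul h1.le, ← Real.rpow_mul h2.le,
          mul_comm a p, mul_comm b p]

/-- The weighted arithmetic-geometric mean inequality, normalized by reference values `U`, `V`. -/
theorem _root_.Real.rpow_mul_rpow_le_of_weights {u v U V a b : ℝ} (hu : 0 ≤ u) (hv : 0 ≤ v)
    (hU : 0 < U) (hV : 0 < V) (ha : 0 ≤ a) (hb : 0 ≤ b) (hab : a + b = 1) :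
    u ^ a * v ^ b ≤ U ^ a * V ^ b * (a / U * u + b / V * v) := by
  have h := Real.geom_mean_le_arith_mean2_weighted ha hb (div_nonneg hu hU.le)
    (div_nonneg hv hV.le) hab
  rw [Real.div_rpow hu hU.le, Real.div_rpow hv hV.le] at h
  have h1 : 0 < U ^ a := Real.rpow_pos_of_pos hU a
  have h2 : 0 < V ^ b := Real.rpow_pos_of_pos hV b
  calc u ^ a * v ^ b = U ^ a * V ^ b * (u ^ a / U ^ a * (v ^ b / V ^ b)) := by field_simp
    _ ≤ U ^ a * V ^ b * (a * (u / U) + b * (v / V)) := by gcongr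
    _ = _ := by ring

/-- Hölder's inequality: a mixture of log-convex functions is log-convex. -/
theorem integral {α : Type*} [MeasurableSpace α] {μ : MeasureTheory.Measure α}
    {k : α → ℝ → ℝ} (hs : Convex ℝ s) (hμ : μ ≠ 0) (hk : ∀ r, IsLogConvexOn s (k r))
    (hint : ∀ x ∈ s, MeasureTheory.Integrable (fun r => k r x) μ) :
    IsLogConvexOn s (fun x => ∫ r, k r x ∂μ) := by
  have hpos : ∀ x ∈ s, 0 < ∫ r, k r x ∂μ := by
    intro x hx
    rw [MeasureTheory.integral_pos_iff_support_of_nonneg (fun r => ((hk r).1 x hx).le) (hint x hx)]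
    have : Function.support (fun r => k r x) = Set.univ := by
      ext r
      simpa using ((hk r).1 x hx).ne'
    rw [this]
    simpa [pos_iff_ne_zero] using hμ
  refine ⟨hpos, fun x hx y hy a b ha hb hab => ?_⟩
  have hz : a * x + b * y ∈ s := hs hx hy ha hb hab
  have hU := hpos x hx
  have hV := hpos y hy
  simp only
  set U := ∫ r, k r x ∂μ with hUdef
  set V := ∫ r, k r y ∂μ with hVdef
  calc ∫ r, k r (a * x + b * y) ∂μ
      ≤ ∫ r, U ^ a * V ^ b * (a / U * k r x + b / V * k r y) ∂μ := by
        refine MeasureTheory.integral_mono (hint _ hz)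
          ((((hint x hx).const_mul _).add ((hint y hy).const_mul _)).const_mul _) fun r => ?_
        exact ((hk r).2 x hx y hy a b ha hb hab).trans
          (Real.rpow_mul_rpow_le_of_weights ((hk r).1 x hx).le ((hk r).1 y hy).le hU hV ha hb hab)
    _ = U ^ a * V ^ b * (a / U * U + b / V * V) := by
        rw [MeasureTheory.integral_const_mul, MeasureTheory.integral_add
          ((hint x hx).const_mul _) ((hint y hy).const_mul _), MeasureTheory.integral_const_mul,
          MeasureTheory.integral_const_mul]
    _ = U ^ a * V ^ b := by
        rw [div_mul_cancel₀ _ hU.ne', div_mul_cancel₀ _ hV.ne', hab, mul_one]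

theorem add (hf : IsLogConvexOn s f) (hg : IsLogConvexOn s g) :
    IsLogConvexOn s (fun x => f x + g x) := by
  refine ⟨fun x hx => add_pos (hf.1 x hx) (hg.1 x hx), fun x hx y hy a b ha hb hab => ?_⟩
  have f1 := hf.1 x hx
  have f2 := hf.1 y hy
  have g1 := hg.1 x hx
  have g2 := hg.1 y hy
  have hU := add_pos f1 g1
  have hV := add_pos f2 g2
  calc f (a * x + b * y) + g (a * x + b * y)
      ≤ (f x + g x) ^ a * (f y + g y) ^ b * (a / (f x + g x) * f x + b / (f y + g y) * f y)
        + (f x + g x) ^ a * (f y + g y) ^ b * (a / (f x + g x) * g x + b / (f y + g y) * g y) :=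
        add_le_add
          ((hf.2 x hx y hy a b ha hb hab).trans
            (Real.rpow_mul_rpow_le_of_weights f1.le f2.le hU hV ha hb hab))
          ((hg.2 x hx y hy a b ha hb hab).trans
            (Real.rpow_mul_rpow_le_of_weights g1.le g2.le hU hV ha hb hab))
    _ = (f x + g x) ^ a * (f y + g y) ^ b * (a / (f x + g x) * (f x + g x)
          + b / (f y + g y) * (f y + g y)) := by ring
    _ = (f x + g x) ^ a * (f y + g y) ^ b := by
        rw [div_mul_cancel₀ _ hU.ne', div_mul_cancel₀ _ hV.ne', hab, mul_one]

theorem inv_affine {d : ℝ} (hd : 0 ≤ d) : IsLogConvexOn (Set.Ici 0) (fun x => (1 + d * x)⁻¹) := by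
  refine ⟨fun x (hx : 0 ≤ x) => by positivity,
    fun x (hx : 0 ≤ x) y (hy : 0 ≤ y) a b ha hb hab => ?_⟩
  have h1 : 0 < 1 + d * x := by positivity
  have h2 : 0 < 1 + d * y := by positivity
  rw [Real.inv_rpow h1.le, Real.inv_rpow h2.le, ← mul_inv]
  refine inv_anti₀ (by positivity) ?_
  refine (Real.geom_mean_le_arith_mean2_weighted ha hb h1.le h2.le hab).trans_eq ?_
  linear_combination hab

theorem exp_mul (d : ℝ) : IsLogConvexOn s (fun x => Real.exp (d * x)) := by
  refine ⟨fun x _ => Real.exp_pos _, fun x _ y _ a b _ _ _ => le_of_eq ?_⟩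
  rw [← Real.exp_mul, ← Real.exp_mul, ← Real.exp_add]
  ring_nf

theorem concaveOn_neg_log (hf : IsLogConvexOn s f) (hs : Convex ℝ s) :
    ConcaveOn ℝ s (fun x => -Real.log (f x)) := by
  refine ⟨hs, fun x hx y hy a b ha hb hab => ?_⟩
  have h1 := hf.1 x hx
  have h2 := hf.1 y hy
  have h := Real.log_le_log (hf.1 _ (hs hx hy ha hb hab)) (hf.2 x hx y hy a b ha hb hab)
  rw [Real.log_mul (by positivity) (by positivity), Real.log_rpow h1, Real.log_rpow h2] at h
  simp only [smul_eq_mul] at h ⊢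
  linarith

end IsLogConvexOn

theorem integral_exp_int_mul_I (d : ℤ) :
    ∫ θ in (-Real.pi)..Real.pi, Complex.exp (d * Complex.I * θ) =
      if d = 0 then 2 * (Real.pi : ℂ) else 0 := by
  split_ifs with hd
  · simp [hd]; ring
  · have hc : (d : ℂ) * Complex.I ≠ 0 := mul_ne_zero (by exact_mod_cast hd) Complex.I_ne_zero
    rw [integral_exp_mul_complex hc, div_eq_zero_iff]
    left
    rw [sub_eq_zero, Complex.exp_eq_exp_iff_exists_int]
    exact ⟨d, by push_cast; ring⟩

/-- Parseval's identity for an absolutely convergent power series on the unit circle. -/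
theorem tsum_sq_eq_integral_norm_sq {b : ℕ → ℝ} (hb : Summable fun k => |b k|) {F : ℝ → ℂ}
    (hF : ∀ θ : ℝ, HasSum (fun k => (b k : ℂ) * Complex.exp (θ * Complex.I) ^ k) (F θ)) :
    ∑' k, b k ^ 2 = (2 * Real.pi)⁻¹ * ∫ θ in (-Real.pi)..Real.pi, ‖F θ‖ ^ 2 := by
  set G : ℕ × ℕ → ℝ → ℂ := fun p θ =>
    (b p.1 * b p.2 : ℝ) * Complex.exp (((p.1 : ℤ) - (p.2 : ℤ) : ℤ) * Complex.I * θ) with hG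
  have hsum2 : Summable fun p : ℕ × ℕ => |b p.1| * |b p.2| :=
    hb.mul_of_nonneg hb (fun _ => abs_nonneg _) (fun _ => abs_nonneg _)
  have hnorm : ∀ p θ, ‖G p θ‖ = |b p.1| * |b p.2| := by
    intro p θ
    have : (((p.1 : ℤ) - (p.2 : ℤ) : ℤ) : ℂ) * Complex.I * θ
        = ((((p.1 : ℤ) - (p.2 : ℤ) : ℤ) * θ : ℝ) : ℂ) * Complex.I := by push_cast; ring
    simp only [hG]
    rw [norm_mul, this, Complex.norm_exp_ofReal_mul_I, Complex.norm_real, mul_one, Real.norm_eq_abs,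
      abs_mul]
  have hcont : ∀ p, Continuous (G p) := by
    intro p
    simp only [hG]
    fun_prop
  have hpt : ∀ θ : ℝ, ∑' p, G p θ = ((‖F θ‖ ^ 2 : ℝ) : ℂ) := by
    intro θ
    have hn : ∀ k, ‖(b k : ℂ) * Complex.exp (θ * Complex.I) ^ k‖ = |b k| := by
      intro k
      rw [norm_mul, norm_pow, Complex.norm_exp_ofReal_mul_I, Complex.norm_real]
      simp
    have hs : Summable fun k => ‖(b k : ℂ) * Complex.exp (θ * Complex.I) ^ k‖ := by
      simpa only [hn] using hb
    have hs' : Summable fun k =>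
        ‖(starRingEnd ℂ) ((b k : ℂ) * Complex.exp (θ * Complex.I) ^ k)‖ := by
      simpa only [RCLike.norm_conj] using hs
    have hconj : ∑' k, (starRingEnd ℂ) ((b k : ℂ) * Complex.exp (θ * Complex.I) ^ k)
        = (starRingEnd ℂ) (F θ) := by
      rw [← (hF θ).tsum_eq, Complex.conj_tsum]
    have := tsum_mul_tsum_of_summable_norm hs hs'
    rw [(hF θ).tsum_eq, hconj, Complex.mul_conj, Complex.normSq_eq_norm_sq] at this
    rw [this]
    refine tsum_congr fun p => ?_
    simp only [hG, map_mul, map_natCast, Complex.conj_ofReal, ← Complex.exp_conj, Complex.conj_I,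
      ← Complex.exp_nat_mul]
    rw [mul_mul_mul_comm, ← Complex.exp_add]
    push_cast
    congr 2
    ring
  have hI : ∀ p, ∫ θ in (-Real.pi)..Real.pi, G p θ
      = if p.1 = p.2 then ((2 * Real.pi * b p.1 ^ 2 : ℝ) : ℂ) else 0 := by
    intro p
    simp only [hG]
    rw [intervalIntegral.integral_const_mul, integral_exp_int_mul_I]
    by_cases h : p.1 = p.2
    · simp [h]; ring
    · have : ((p.1 : ℤ) - (p.2 : ℤ)) ≠ 0 := by omega
      simp [h, this]
  have hle : -Real.pi ≤ Real.pi := by linarith [Real.pi_pos]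
  have hHas := intervalIntegral.hasSum_integral_of_dominated_convergence
    (μ := MeasureTheory.volume) (a := -Real.pi) (b := Real.pi) (F := G)
    (f := fun θ => ((‖F θ‖ ^ 2 : ℝ) : ℂ)) (fun p _ => |b p.1| * |b p.2|)
    (fun p => (hcont p).aestronglyMeasurable)
    (fun p => Filter.Eventually.of_forall fun θ _ => (hnorm p θ).le)
    (Filter.Eventually.of_forall fun _ _ => hsum2)
    (by simp)
    (Filter.Eventually.of_forall fun θ _ => by
      rw [← hpt θ]
      exact (Summable.of_norm (by simpa only [hnorm] using hsum2)).hasSum)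
  rw [intervalIntegral.integral_ofReal] at hHas
  simp only [hI] at hHas
  have hinj : Function.Injective fun k : ℕ => ((k, k) : ℕ × ℕ) := fun i j h => congrArg Prod.fst h
  rw [← hinj.hasSum_iff] at hHas
  · have h2 : HasSum (fun k => 2 * Real.pi * b k ^ 2)
        (∫ θ in (-Real.pi)..Real.pi, ‖F θ‖ ^ 2) := by
      rw [← Complex.hasSum_ofReal]
      simpa [Function.comp_def] using hHas
    have hpi : (2 * Real.pi) ≠ 0 := by positivity
    rw [← h2.tsum_eq, tsum_mul_left, inv_mul_cancel_left₀ hpi]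
  · rintro ⟨i, j⟩ hij
    rw [if_neg]
    rintro (rfl : i = j)
    exact hij ⟨i, rfl⟩

open MeasureTheory

theorem genBinom_eq_choose (a : ℝ) (k : ℕ) : genBinom a k = Ring.choose a k := by
  rw [Ring.choose_eq_smul, ← Polynomial.aeval_eq_smeval, Polynomial.aeval_def,
    ← Polynomial.eval_map, descPochhammer_map, descPochhammer_eval_eq_prod_range, genBinom,
    smul_eq_mul, div_eq_inv_mul]

theorem summable_abs_choose_mul_pow (a : ℝ) {q : ℝ} (hq : |q| < 1) :
    Summable fun k : ℕ => |Ring.choose a k * q ^ k| := by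
  have h : q ∈ Metric.eball (0 : ℝ) (binomialSeries ℝ a).radius := by
    refine Metric.eball_subset_eball (binomialSeries_radius_ge_one (𝕂 := ℝ) (𝔸 := ℝ) (a := a)) ?_
    rw [Metric.mem_eball, edist_zero_right, ← ofReal_norm, ENNReal.ofReal_lt_one]
    exact hq
  have := (binomialSeries ℝ a).summable_norm_apply h
  simpa only [binomialSeries_apply, List.ofFn_const, List.prod_replicate, smul_eq_mul,
    Real.norm_eq_abs] using this

theorem hasSum_choose_mul_pow (a : ℝ) {z : ℂ} (hz : ‖z‖ < 1) :
    HasSum (fun k : ℕ => (Ring.choose a k : ℂ) * z ^ k) ((1 + z) ^ (a : ℂ)) := by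
  have h := (Complex.one_add_cpow_hasFPowerSeriesOnBall_zero (a := (a : ℂ))).hasSum (y := z)
    (by rwa [Metric.mem_eball, edist_zero_right, ← ofReal_norm, ENNReal.ofReal_lt_one])
  simpa only [binomialSeries_apply, List.ofFn_const, List.prod_replicate, smul_eq_mul,
    Complex.ofReal_choose, zero_add] using h

theorem norm_one_sub_mul_exp_sq (q θ : ℝ) :
    ‖1 - (q : ℂ) * Complex.exp (θ * Complex.I)‖ ^ 2 = 1 - 2 * q * Real.cos θ + q ^ 2 := by
  rw [← Complex.normSq_eq_norm_sq, Complex.normSq_apply, Complex.exp_mul_I, ← Complex.ofReal_cos,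
    ← Complex.ofReal_sin]
  simp [-Complex.ofReal_cos, -Complex.ofReal_sin]
  linear_combination q ^ 2 * Real.sin_sq_add_cos_sq θ

theorem tsum_sq_choose_mul_pow (a : ℝ) {q : ℝ} (hq : |q| < 1) :
    ∑' k : ℕ, (Ring.choose a k * (-q) ^ k) ^ 2 = (2 * Real.pi)⁻¹ *
      ∫ θ in (-Real.pi)..Real.pi, (1 - 2 * q * Real.cos θ + q ^ 2) ^ a := by
  rw [tsum_sq_eq_integral_norm_sq
    (F := fun θ => (1 - (q : ℂ) * Complex.exp (θ * Complex.I)) ^ (a : ℂ))]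
  · congr 2
    ext θ
    rw [← norm_one_sub_mul_exp_sq, Complex.norm_cpow_real, ← Real.rpow_natCast_mul (norm_nonneg _),
      ← Real.rpow_mul_natCast (norm_nonneg _), mul_comm a]
  · exact summable_abs_choose_mul_pow a (by simpa using hq)
  · intro θ
    have h := hasSum_choose_mul_pow a (z := -(q * Complex.exp (θ * Complex.I)))
      (by rw [norm_neg, norm_mul, Complex.norm_exp_ofReal_mul_I]; simpa using hq)
    rw [sub_eq_add_neg]
    convert h using 2 with k
    rw [← neg_mul, mul_pow]
    push_cast
    ring

theorem tsum_sq_pow_div_factorial (l : ℝ) :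
    ∑' k : ℕ, (l ^ k / (Nat.factorial k)) ^ 2 = (2 * Real.pi)⁻¹ *
      ∫ θ in (-Real.pi)..Real.pi, Real.exp (2 * l * Real.cos θ) := by
  rw [tsum_sq_eq_integral_norm_sq
    (F := fun θ => Complex.exp (l * Complex.exp (θ * Complex.I)))]
  · congr 2
    ext θ
    rw [Complex.norm_exp, ← Real.exp_nat_mul, Complex.exp_mul_I, ← Complex.ofReal_cos,
      ← Complex.ofReal_sin]
    simp [-Complex.ofReal_cos, -Complex.ofReal_sin]
    ring
  · simpa [abs_div] using Real.summable_pow_div_factorial |l|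
  · intro θ
    have h := NormedSpace.expSeries_div_hasSum_exp (l * Complex.exp (θ * Complex.I))
    rw [← Complex.exp_eq_exp_ℂ] at h
    refine h.congr_fun fun k => ?_
    rw [mul_pow]
    push_cast
    ring

theorem Sc_zero_left (n x : ℝ) :
    Sc 0 n x = (2 * Real.pi)⁻¹ *
      ∫ θ in (-Real.pi)..Real.pi, Real.exp (-(2 * n * (1 - Real.cos θ)) * x) := by
  have h : ∀ k, pc 0 n k x ^ 2 =
      ((n * x) ^ k / (Nat.factorial k)) ^ 2 * Real.exp (-(2 * (n * x))) := by
    intro k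
    rw [pc, if_pos rfl, mul_pow, ← Real.exp_nat_mul]
    push_cast
    ring_nf
  rw [Sc, tsum_congr h, tsum_mul_right, tsum_sq_pow_div_factorial, mul_assoc,
    ← intervalIntegral.integral_mul_const]
  congr 2
  ext θ
  rw [← Real.exp_add]
  ring_nf

theorem integral_comp_cos_eq (g : ℝ → ℝ) :
    ∫ θ in (-Real.pi)..Real.pi, g (Real.cos θ) =
      ∫ s : ℝ, 2 / (1 + s ^ 2) * g ((1 - s ^ 2) / (1 + s ^ 2)) := by
  have himg : (fun s : ℝ => 2 * Real.arctan s) '' Set.univ = Set.Ioo (-Real.pi) Real.pi := by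
    ext θ
    simp only [Set.image_univ, Set.mem_range, Set.mem_Ioo]
    constructor
    · rintro ⟨s, rfl⟩
      have := Real.neg_pi_div_two_lt_arctan s
      have := Real.arctan_lt_pi_div_two s
      constructor <;> linarith
    · rintro ⟨h1, h2⟩
      refine ⟨Real.tan (θ / 2), ?_⟩
      rw [Real.arctan_tan (by linarith) (by linarith)]
      ring
  rw [intervalIntegral.integral_of_le (by linarith [Real.pi_pos]), integral_Ioc_eq_integral_Ioo,
    ← himg, integral_image_eq_integral_abs_deriv_smul MeasurableSet.univ
      (f' := fun s => 2 * (1 / (1 + s ^ 2)))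
      (fun s _ => ((Real.hasDerivAt_arctan s).const_mul 2).hasDerivWithinAt)
      (fun s _ t _ h => Real.arctan_injective (by simpa using h)), setIntegral_univ]
  congr 1
  ext s
  have h : 0 < 1 + s ^ 2 := by positivity
  rw [Real.cos_two_mul, Real.cos_sq_arctan, abs_of_pos (by positivity), smul_eq_mul]
  congr 2
  · ring
  · field_simp
    ring

/-- The kernel whose mixture over `r : ℝ` represents `Sc c n`, where `c > 0` and `m = n / c`. -/
noncomputable def scKernel (c m r x : ℝ) : ℝ :=
  (1 + r ^ 2)⁻¹ * ((1 + 2 * c * x)⁻¹ *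
    ((1 + r ^ 2)⁻¹ * (1 + r ^ 2 * (1 + 2 * c * x)⁻¹ ^ (2 : ℝ))) ^ (m - 1))

theorem Sc_of_pos {c n x : ℝ} (hc : 0 < c) (hx : 0 ≤ x) :
    Sc c n x = Real.pi⁻¹ * ∫ r : ℝ, scKernel c (n / c) r x := by
  set m := n / c with hm
  set u := c * x with hu
  have hu0 : 0 ≤ u := by positivity
  have hu1 : 0 < 1 + u := by positivity
  set q := u / (1 + u) with hq
  have hq0 : 0 ≤ q := by positivity
  have hq1 : q < 1 := by rw [hq, div_lt_one hu1]; linarith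
  have h : ∀ k, pc c n k x ^ 2 = (Ring.choose (-m) k * (-q) ^ k) ^ 2 * (1 + u) ^ (-(2 * m)) := by
    intro k
    rw [pc, if_neg hc.ne', neg_div, ← hm, ← hu, genBinom_eq_choose, Real.rpow_sub hu1,
      Real.rpow_natCast, show -(2 * m) = (-m) * (2 : ℕ) by push_cast; ring,
      Real.rpow_mul_natCast hu1.le, hq, neg_eq_neg_one_mul (u / (1 + u)), mul_pow (-1 : ℝ), div_pow]
    ring
  rw [Sc, tsum_congr h, tsum_mul_right,
    tsum_sq_choose_mul_pow (-m) (by rwa [abs_of_nonneg hq0]),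
    integral_comp_cos_eq (fun t => (1 - 2 * q * t + q ^ 2) ^ (-m)), mul_assoc,
    ← integral_mul_const]
  have hy : 0 < 1 + 2 * c * x := by positivity
  have hyu : 1 + 2 * c * x = 1 + 2 * u := by rw [hu]; ring
  rw [hyu] at hy
  have key := Measure.integral_comp_mul_left (fun s : ℝ => 2 / (1 + s ^ 2) *
    (1 - 2 * q * ((1 - s ^ 2) / (1 + s ^ 2)) + q ^ 2) ^ (-m) * (1 + u) ^ (-(2 * m)))
    (1 + 2 * u)⁻¹
  rw [inv_inv, abs_of_pos hy, smul_eq_mul] at key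
  rw [← inv_mul_eq_iff_eq_mul₀ hy.ne'] at key
  rw [← key, ← integral_const_mul, ← integral_const_mul, ← integral_const_mul]
  congr 1
  ext r
  rw [scKernel, hyu]
  set v := (1 + 2 * u)⁻¹ with hv
  have hv0 : 0 < v := by positivity
  have hr : 0 < 1 + r ^ 2 := by positivity
  have hvr : 0 < 1 + (v * r) ^ 2 := by positivity
  have hbase : (1 - 2 * q * ((1 - (v * r) ^ 2) / (1 + (v * r) ^ 2)) + q ^ 2) * (1 + u) ^ 2
      = ((1 + r ^ 2)⁻¹ * (1 + r ^ 2 * v ^ 2))⁻¹ := by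
    rw [hq, hv]
    field_simp
    ring
  have hB : 0 ≤ 1 - 2 * q * ((1 - (v * r) ^ 2) / (1 + (v * r) ^ 2)) + q ^ 2 := by
    refine le_of_mul_le_mul_right ?_ (pow_pos hu1 2)
    rw [hbase, zero_mul]
    positivity
  have hD : 0 < (1 + r ^ 2)⁻¹ * (1 + r ^ 2 * v ^ 2) := by positivity
  rw [mul_assoc (2 / _), show -(2 * m) = ((2 : ℕ) : ℝ) * (-m) by push_cast; ring,
    Real.rpow_natCast_mul hu1.le, ← Real.mul_rpow hB (by positivity), hbase,
    Real.inv_rpow hD.le, Real.rpow_neg hD.le, inv_inv, Real.rpow_two, Real.rpow_sub_one hD.ne']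
  field_simp

theorem isLogConvexOn_scKernel {c m : ℝ} (hc : 0 < c) (hm : 1 ≤ m) (r : ℝ) :
    IsLogConvexOn (Set.Ici 0) (scKernel c m r) := by
  have hs := convex_Ici (𝕜 := ℝ) (0 : ℝ)
  have hv : IsLogConvexOn (Set.Ici 0) fun x => (1 + 2 * c * x)⁻¹ :=
    IsLogConvexOn.inv_affine (by positivity)
  have hone : IsLogConvexOn (Set.Ici 0) fun x : ℝ =>
      1 + r ^ 2 * (1 + 2 * c * x)⁻¹ ^ (2 : ℝ) := by
    rcases eq_or_ne r 0 with rfl | hr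
    · simpa using IsLogConvexOn.const (s := Set.Ici 0) one_pos
    · exact (IsLogConvexOn.const one_pos).add
        ((IsLogConvexOn.const (by positivity)).mul (hv.rpow_const hs two_pos.le) hs)
  have hC : IsLogConvexOn (Set.Ici 0) fun _ => (1 + r ^ 2)⁻¹ :=
    IsLogConvexOn.const (by positivity)
  exact hC.mul (hv.mul ((hC.mul hone hs).rpow_const hs (by linarith)) hs) hs

theorem scKernel_antitoneOn {c m : ℝ} (hc : 0 < c) (hm : 1 ≤ m) (r : ℝ) :
    AntitoneOn (scKernel c m r) (Set.Ici 0) := by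
  intro x (hx : 0 ≤ x) y (hy : 0 ≤ y) hxy
  have h : (1 + 2 * c * y)⁻¹ ≤ (1 + 2 * c * x)⁻¹ := by gcongr
  have h0 : 0 < (1 + 2 * c * y)⁻¹ := by positivity
  have h1 : 0 ≤ m - 1 := by linarith
  unfold scKernel
  gcongr

theorem integrable_scKernel {c m x : ℝ} (hc : 0 < c) (hm : 1 ≤ m) (hx : 0 ≤ x) :
    Integrable fun r => scKernel c m r x := by
  refine integrable_inv_one_add_sq.mono' ?_ (Filter.Eventually.of_forall fun r => ?_)
  · unfold scKernel
    exact Measurable.aestronglyMeasurable (by fun_prop)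
  · rw [Real.norm_of_nonneg ((isLogConvexOn_scKernel hc hm r).1 x hx).le]
    refine (scKernel_antitoneOn hc hm r (le_refl (0 : ℝ)) hx hx).trans_eq ?_
    have hr : 1 + r ^ 2 ≠ 0 := by positivity
    simp [scKernel, inv_mul_cancel₀ hr]

theorem concaveOn_and_monotoneOn_of_kernel {α : Type*} [MeasurableSpace α] {μ : Measure α}
    (hμ : μ ≠ 0) {k : α → ℝ → ℝ} {C c n : ℝ} (hC : 0 < C)
    (hSc : ∀ x, 0 ≤ x → Sc c n x = C * ∫ r, k r x ∂μ)
    (hk : ∀ r, IsLogConvexOn (Set.Ici 0) (k r)) (hanti : ∀ r, AntitoneOn (k r) (Set.Ici 0))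
    (hint : ∀ x ∈ Set.Ici (0 : ℝ), Integrable (fun r => k r x) μ) :
    ConcaveOn ℝ (Set.Ici 0) (Rc c n) ∧ MonotoneOn (Rc c n) (Set.Ici 0) := by
  have hs := convex_Ici (𝕜 := ℝ) (0 : ℝ)
  have hlc : IsLogConvexOn (Set.Ici 0) fun x => C * ∫ r, k r x ∂μ :=
    (IsLogConvexOn.const hC).mul (IsLogConvexOn.integral hs hμ hk hint) hs
  have heq : Set.EqOn (fun x => -Real.log (C * ∫ r, k r x ∂μ)) (Rc c n) (Set.Ici 0) := by
    intro x hx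
    simp only [Rc, hSc x hx]
  refine ⟨(hlc.concaveOn_neg_log hs).congr heq, MonotoneOn.congr ?_ heq⟩
  intro x hx y hy hxy
  refine neg_le_neg (Real.log_le_log (hlc.1 y hy) ?_)
  exact mul_le_mul_of_nonneg_left
    (integral_mono (hint y hy) (hint x hx) fun r => hanti r hx hy hxy) hC.le

theorem stmt10 (c n : ℝ) (hc : 0 ≤ c) (hn : c < n) :
    ConcaveOn ℝ (Set.Ici 0) (Rc c n) ∧ MonotoneOn (Rc c n) (Set.Ici 0) := by
  rcases hc.eq_or_lt with rfl | hc
  · have hle : -Real.pi ≤ Real.pi := by linarith [Real.pi_pos]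
    refine concaveOn_and_monotoneOn_of_kernel
      (μ := volume.restrict (Set.Ioc (-Real.pi) Real.pi)) ?_ (C := (2 * Real.pi)⁻¹)
      (k := fun θ x => Real.exp (-(2 * n * (1 - Real.cos θ)) * x)) (by positivity)
      (fun x _ => by rw [Sc_zero_left, intervalIntegral.integral_of_le hle])
      (fun θ => IsLogConvexOn.exp_mul _) (fun θ x _ y _ hxy => ?_) (fun x _ => ?_)
    · rw [Ne, Measure.restrict_eq_zero, Real.volume_Ioc]
      simp [Real.pi_pos]
    · have : 0 ≤ 2 * n * (1 - Real.cos θ) :=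
        mul_nonneg (by linarith) (by linarith [Real.cos_le_one θ])
      refine Real.exp_le_exp.2 ?_
      nlinarith
    · exact Continuous.integrableOn_Ioc (by fun_prop)
  · have hm : 1 ≤ n / c := by rw [le_div_iff₀ hc]; linarith
    exact concaveOn_and_monotoneOn_of_kernel (μ := volume) (NeZero.ne _)
      (inv_pos.2 Real.pi_pos) (fun x hx => Sc_of_pos hc hx)
      (isLogConvexOn_scKernel hc hm) (scKernel_antitoneOn hc hm)
      (fun x hx => integrable_scKernel hc hm hx)
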